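/- For every integer α ≥ 2, every deterministic online algorithm for the non-preemptive energy minimization problem on a single machine with power function P(s) = s^α has competitive ratio at least (α/9)^α: there exists an instance of jobs with release times, deadlines and volumes, all of which must be completed non-preemptively at a constant speed within their spans, on which the algorithm's total energy consumption is at least (α/9)^α times the optimal offline energy consumption. -/

import Mathlib

open Finset MeasureTheory
open scoped Classical

/-- A single-machine instance of the non-preemptive energy minimization problem:
a finite set of jobs, job `j` having a release time `r j ≥ 0`, a deadline `d j` and a
processing volume `p j > 0`. -/
structure EInstance where
  jobs : Finset ℕ
  r : ℕ → ℝ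
  d : ℕ → ℝ
  p : ℕ → ℝ
  r_nonneg : ∀ j ∈ jobs, 0 ≤ r j
  r_lt_d : ∀ j ∈ jobs, r j < d j
  p_pos : ∀ j ∈ jobs, 0 < p j

/-- A schedule assigns each job a starting time and a constant speed; the machine may
run several jobs in parallel. -/
structure ESchedule where
  start : ℕ → ℝ
  speed : ℕ → ℝ

/-- A feasible schedule: every job runs at a positive constant speed entirely within
its span `[r j, d j]`. -/
def EFeasible (I : EInstance) (σ : ESchedule) : Prop :=
  ∀ j ∈ I.jobs, 0 < σ.speed j ∧ I.r j ≤ σ.start j ∧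
    σ.start j + I.p j / σ.speed j ≤ I.d j

/-- The speed of the machine at time `t`: the sum of the speeds of the jobs being
executed at time `t`. -/
noncomputable def machineSpeed (I : EInstance) (σ : ESchedule) (t : ℝ) : ℝ :=
  ∑ j ∈ I.jobs.filter
      (fun j => σ.start j ≤ t ∧ t < σ.start j + I.p j / σ.speed j),
    σ.speed j

/-- The total energy consumption `∫ (s(t))^α dt` of a schedule. -/
noncomputable def eEnergy (I : EInstance) (σ : ESchedule) (α : ℕ) : ℝ :=
  ∫ t in Set.Ici (0 : ℝ), (machineSpeed I σ t) ^ α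

/-- Two instances agree up to time `t`. -/
def EAgreeUpTo (I₁ I₂ : EInstance) (t : ℝ) : Prop :=
  I₁.jobs.filter (fun j => I₁.r j ≤ t) = I₂.jobs.filter (fun j => I₂.r j ≤ t) ∧
  ∀ j ∈ I₁.jobs.filter (fun j => I₁.r j ≤ t),
    I₁.r j = I₂.r j ∧ I₁.d j = I₂.d j ∧ I₁.p j = I₂.p j

/-- A deterministic algorithm outputs a schedule for each instance. -/
def EAlgo := EInstance → ESchedule

/-- An algorithm is online (and its decisions irrevocable): the starting time and speed
of every job started by time `t` depend only on the jobs released by time `t`. -/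
def EOnline (A : EAlgo) : Prop :=
  ∀ (I₁ I₂ : EInstance) (t : ℝ), EAgreeUpTo I₁ I₂ t →
    ∀ j ∈ I₁.jobs.filter (fun j => I₁.r j ≤ t),
      ((A I₁).start j ≤ t ∨ (A I₂).start j ≤ t) →
      (A I₁).start j = (A I₂).start j ∧ (A I₁).speed j = (A I₂).speed j

/-- The optimal offline energy consumption of an instance. -/
noncomputable def EOPT (I : EInstance) (α : ℕ) : ℝ :=
  sInf {E : ℝ | ∃ σ : ESchedule, EFeasible I σ ∧ E = eEnergy I σ α}

theorem machineSpeed_eq_sum_indicator (I : EInstance) (σ : ESchedule) (t : ℝ) :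
    machineSpeed I σ t = ∑ j ∈ I.jobs,
      (Set.Ico (σ.start j) (σ.start j + I.p j / σ.speed j)).indicator
        (fun _ => σ.speed j) t := by
  unfold machineSpeed
  rw [Finset.sum_filter]
  exact Finset.sum_congr rfl fun j _ => by simp [Set.indicator_apply]

theorem integrable_machineSpeed_pow (I : EInstance) (σ : ESchedule) {α : ℕ} (hα : α ≠ 0) :
    Integrable fun t => machineSpeed I σ t ^ α := by
  have hmem : MemLp (machineSpeed I σ) α volume := by
    have hsum : MemLp (fun t => ∑ j ∈ I.jobs,
        (Set.Ico (σ.start j) (σ.start j + I.p j / σ.speed j)).indicator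
          (fun _ => σ.speed j) t) α volume :=
      memLp_finsetSum _ fun j _ =>
        memLp_indicator_const _ measurableSet_Ico _ (Or.inr measure_Ico_lt_top.ne)
    exact (funext (machineSpeed_eq_sum_indicator I σ)) ▸ hsum
  have hnorm := hmem.integrable_norm_pow hα
  refine hnorm.mono (hmem.1.pow α) (Filter.Eventually.of_forall fun t => ?_)
  simp

theorem machineSpeed_nonneg {I : EInstance} {σ : ESchedule} (h : EFeasible I σ) (t : ℝ) :
    0 ≤ machineSpeed I σ t :=
  Finset.sum_nonneg fun j hj => (h j (Finset.mem_filter.1 hj).1).1.le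

theorem eEnergy_nonneg {I : EInstance} {σ : ESchedule} (h : EFeasible I σ) (α : ℕ) :
    0 ≤ eEnergy I σ α :=
  integral_nonneg fun t => pow_nonneg (machineSpeed_nonneg h t) α

/-- A machine that runs at speed at least `c` during `[a, a + D)` consumes at least `c ^ α * D`. -/
theorem pow_mul_le_eEnergy {I : EInstance} {σ : ESchedule} (h : EFeasible I σ) {α : ℕ}
    (hα : α ≠ 0) {a D c : ℝ} (ha : 0 ≤ a) (hD : 0 ≤ D) (hc : 0 ≤ c)
    (hs : ∀ t ∈ Set.Ico a (a + D), c ≤ machineSpeed I σ t) :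
    c ^ α * D ≤ eEnergy I σ α := by
  have hsub : Set.Ico a (a + D) ⊆ Set.Ici 0 := fun t ht => ha.trans ht.1
  calc c ^ α * D = ∫ _ in Set.Ico a (a + D), c ^ α := by
        simp [hD, mul_comm]
    _ ≤ ∫ t in Set.Ico a (a + D), machineSpeed I σ t ^ α :=
        setIntegral_mono_on (by simp)
          (integrable_machineSpeed_pow I σ hα).integrableOn measurableSet_Ico
          fun t ht => pow_le_pow_left₀ hc (hs t ht) α
    _ ≤ eEnergy I σ α :=
        setIntegral_mono_set (integrable_machineSpeed_pow I σ hα).integrableOn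
          (Filter.Eventually.of_forall fun t => pow_nonneg (machineSpeed_nonneg h t) α)
          hsub.eventuallyLE

/-- The energy of a schedule that runs at most one job at a time. -/
theorem eEnergy_le_of_pairwise_disjoint {I : EInstance} {σ : ESchedule} (h : EFeasible I σ)
    {α : ℕ} (hα : α ≠ 0)
    (hdisj : ∀ i ∈ I.jobs, ∀ j ∈ I.jobs, ∀ t,
      t ∈ Set.Ico (σ.start i) (σ.start i + I.p i / σ.speed i) →
      t ∈ Set.Ico (σ.start j) (σ.start j + I.p j / σ.speed j) → i = j) :
    eEnergy I σ α ≤ ∑ j ∈ I.jobs, σ.speed j ^ α * (I.p j / σ.speed j) := by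
  set S : ℕ → Set ℝ := fun j => Set.Ico (σ.start j) (σ.start j + I.p j / σ.speed j) with hS
  set g : ℕ → ℝ → ℝ := fun j => (S j).indicator fun _ => σ.speed j ^ α with hg
  have hgint : ∀ j, Integrable (g j) := fun j =>
    (integrable_indicator_iff measurableSet_Ico).2 (by simp)
  have hgnn : ∀ j ∈ I.jobs, ∀ t, 0 ≤ g j t := fun j hj t =>
    Set.indicator_nonneg (fun _ _ => pow_nonneg (h j hj).1.le α) t
  have hle : ∀ t, machineSpeed I σ t ^ α ≤ ∑ j ∈ I.jobs, g j t := by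
    intro t
    rw [machineSpeed_eq_sum_indicator]
    by_cases hex : ∃ i ∈ I.jobs, t ∈ S i
    · obtain ⟨i, hi, hti⟩ := hex
      have hne : ∀ j ∈ I.jobs, j ≠ i → t ∉ S j := fun j hj hji htj =>
        hji (hdisj j hj i hi t htj hti)
      rw [Finset.sum_eq_single_of_mem i hi fun j hj hji =>
        Set.indicator_of_notMem (hne j hj hji) _, Set.indicator_of_mem hti]
      calc σ.speed i ^ α = g i t := (Set.indicator_of_mem hti fun _ => σ.speed i ^ α).symm
        _ ≤ _ := Finset.single_le_sum (f := fun j => g j t) (fun j hj => hgnn j hj t) hi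
    · push Not at hex
      rw [Finset.sum_eq_zero fun j hj => Set.indicator_of_notMem (hex j hj) _, zero_pow hα]
      exact Finset.sum_nonneg fun j hj => hgnn j hj t
  calc eEnergy I σ α ≤ ∫ t in Set.Ici (0 : ℝ), ∑ j ∈ I.jobs, g j t :=
        integral_mono_of_nonneg
          (Filter.Eventually.of_forall fun t => pow_nonneg (machineSpeed_nonneg h t) α)
          (integrable_finsetSum _ fun j _ => (hgint j).integrableOn)
          (Filter.Eventually.of_forall hle)
    _ ≤ ∫ t, ∑ j ∈ I.jobs, g j t :=
        setIntegral_le_integral (integrable_finsetSum _ fun j _ => hgint j)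
          (Filter.Eventually.of_forall fun t => Finset.sum_nonneg fun j hj => hgnn j hj t)
    _ = ∑ j ∈ I.jobs, ∫ t, g j t := integral_finsetSum _ fun j _ => hgint j
    _ = _ := Finset.sum_congr rfl fun j hj => by
        have hD : 0 ≤ I.p j / σ.speed j := (div_pos (I.p_pos j hj) (h j hj).1).le
        rw [hg]
        simp only
        rw [integral_indicator measurableSet_Ico]
        simp [hD, mul_comm]

theorem EOPT_le_eEnergy {I : EInstance} {σ : ESchedule} (h : EFeasible I σ) (α : ℕ) :
    EOPT I α ≤ eEnergy I σ α :=
  csInf_le ⟨0, by rintro _ ⟨τ, hτ, rfl⟩; exact eEnergy_nonneg hτ α⟩ ⟨σ, h, rfl⟩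

/-- A feasible schedule runs every job at least at the density of the job. -/
theorem EFeasible.density_le_speed {I : EInstance} {σ : ESchedule} (h : EFeasible I σ) {j : ℕ}
    (hj : j ∈ I.jobs) : I.p j / (I.d j - I.r j) ≤ σ.speed j := by
  obtain ⟨hs, hr, hd⟩ := h j hj
  have hD : I.p j / σ.speed j ≤ I.d j - I.r j := by linarith
  rw [div_le_iff₀ (by linarith [I.r_lt_d j hj])]
  rw [div_le_iff₀ hs] at hD
  linarith

theorem EOPT_pos {I : EInstance} (hI : I.jobs.Nonempty) {σ₀ : ESchedule} (h₀ : EFeasible I σ₀)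
    {α : ℕ} (hα : α ≠ 0) : 0 < EOPT I α := by
  obtain ⟨j, hj⟩ := hI
  have hL : 0 < I.d j - I.r j := sub_pos.2 (I.r_lt_d j hj)
  have hp := I.p_pos j hj
  have hlb : (I.p j / (I.d j - I.r j)) ^ (α - 1) * I.p j ≤ EOPT I α := by
    refine le_csInf ⟨_, σ₀, h₀, rfl⟩ ?_
    rintro _ ⟨σ, h, rfl⟩
    obtain ⟨hs, hr, -⟩ := h j hj
    have henergy : σ.speed j ^ α * (I.p j / σ.speed j) ≤ eEnergy I σ α := by
      refine pow_mul_le_eEnergy h hα ((I.r_nonneg j hj).trans hr) (div_pos hp hs).le hs.le ?_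
      intro t ht
      exact Finset.single_le_sum (f := fun i => σ.speed i)
        (fun i hi => (h i (Finset.mem_filter.1 hi).1).1.le) (Finset.mem_filter.2 ⟨hj, ht⟩)
    refine le_trans ?_ henergy
    have heq : σ.speed j ^ α * (I.p j / σ.speed j) = σ.speed j ^ (α - 1) * I.p j := by
      obtain ⟨n, rfl⟩ := Nat.exists_eq_succ_of_ne_zero hα
      simp only [Nat.succ_eq_add_one, Nat.add_sub_cancel, pow_succ]
      field_simp
    rw [heq]
    have := h.density_le_speed hj
    gcongr
  exact lt_of_lt_of_le (by positivity) hlb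

/-- The jobs of `I` are `0, …, k`, job `j` has density `u j` with `(u j) ^ α * (d j - r j) = 1`,
and the span of every job is the middle third of the execution interval which the schedule `σ`
assigns to the preceding job. -/
structure IsNestedChain (α k : ℕ) (I : EInstance) (σ : ESchedule) (u : ℕ → ℝ) : Prop where
  jobs_eq : I.jobs = Finset.range (k + 1)
  u_pos : ∀ j ≤ k, 0 < u j
  u_pow : ∀ j ≤ k, u j ^ α * (I.d j - I.r j) = 1
  p_eq : ∀ j ≤ k, I.p j = u j * (I.d j - I.r j)
  r_succ : ∀ j < k, I.r (j + 1) = σ.start j + I.p j / σ.speed j / 3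
  d_succ : ∀ j < k, I.d (j + 1) = σ.start j + 2 * (I.p j / σ.speed j / 3)

namespace IsNestedChain

variable {α k : ℕ} {I : EInstance} {σ : ESchedule} {u : ℕ → ℝ}

theorem mem_jobs (hc : IsNestedChain α k I σ u) {j : ℕ} (hj : j ≤ k) : j ∈ I.jobs := by
  rw [hc.jobs_eq]
  exact Finset.mem_range.2 (Nat.lt_succ_of_le hj)

theorem duration_pos (hc : IsNestedChain α k I σ u) (h : EFeasible I σ) {j : ℕ} (hj : j ≤ k) :
    0 < I.p j / σ.speed j :=
  div_pos (I.p_pos j (hc.mem_jobs hj)) (h j (hc.mem_jobs hj)).1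

theorem execution_nested (hc : IsNestedChain α k I σ u) (h : EFeasible I σ) {i j : ℕ}
    (hij : i ≤ j) (hj : j ≤ k) :
    σ.start i ≤ σ.start j ∧
      σ.start j + I.p j / σ.speed j ≤ σ.start i + I.p i / σ.speed i := by
  induction j, hij using Nat.le_induction with
  | base => exact ⟨le_rfl, le_rfl⟩
  | succ j hij ih =>
    obtain ⟨h1, h2⟩ := ih (by omega)
    have hD := hc.duration_pos h (j := j) (by omega)
    obtain ⟨-, h3, h4⟩ := h (j + 1) (hc.mem_jobs hj)
    rw [hc.r_succ j hj] at h3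
    rw [hc.d_succ j hj] at h4
    constructor <;> linarith

theorem span_nested (hc : IsNestedChain α k I σ u) (h : EFeasible I σ) {i j : ℕ}
    (hij : i ≤ j) (hj : j ≤ k) : I.r i ≤ I.r j ∧ I.d j ≤ I.d i := by
  induction j, hij using Nat.le_induction with
  | base => exact ⟨le_rfl, le_rfl⟩
  | succ j hij ih =>
    obtain ⟨h1, h2⟩ := ih (by omega)
    have hD := hc.duration_pos h (j := j) (by omega)
    obtain ⟨-, h3, h4⟩ := h j (hc.mem_jobs (by omega))
    rw [hc.r_succ j hj, hc.d_succ j hj]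
    constructor <;> linarith

/-- Running every job in a third of its span that avoids the spans of the later jobs. -/
theorem EOPT_le (hc : IsNestedChain α k I σ u) (h : EFeasible I σ) (hα : α ≠ 0) :
    EOPT I α ≤ (k + 1) * 3 ^ (α - 1) := by
  set L : ℕ → ℝ := fun j => I.d j - I.r j with hL
  have hLpos : ∀ j ≤ k, 0 < L j := fun j hj => sub_pos.2 (I.r_lt_d j (hc.mem_jobs hj))
  let τ : ESchedule :=
    { start := fun j => if L j / 3 ≤ σ.start j + I.p j / σ.speed j / 3 - I.r j
        then I.r j else I.d j - L j / 3
      speed := fun j => 3 * u j }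
  have hdur : ∀ j ≤ k, I.p j / τ.speed j = L j / 3 := fun j hj => by
    have := (hc.u_pos j hj).ne'
    simp only [τ, hc.p_eq j hj, hL]
    field_simp
  have hin : ∀ j ≤ k, I.r j ≤ τ.start j ∧ τ.start j + L j / 3 ≤ I.d j := fun j hj => by
    have := hLpos j hj
    simp only [τ]
    split_ifs <;> constructor <;> simp only [hL] at * <;> linarith
  have hτ : EFeasible I τ := fun j hj => by
    have hjk : j ≤ k := by
      rw [hc.jobs_eq, Finset.mem_range] at hj
      omega
    refine ⟨mul_pos three_pos (hc.u_pos j hjk), (hin j hjk).1, ?_⟩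
    rw [hdur j hjk]
    exact (hin j hjk).2
  have havoid : ∀ i j, i < j → j ≤ k → ∀ t, t ∈ Set.Ico (τ.start i) (τ.start i + L i / 3) →
      t ∉ Set.Ico (τ.start j) (τ.start j + L j / 3) := by
    intro i j hij hj t hti htj
    obtain ⟨h1, h2⟩ := hc.span_nested h (Nat.succ_le_of_lt hij) hj
    obtain ⟨h3, h4⟩ := hin j hj
    rw [Nat.succ_eq_add_one, hc.r_succ i (by omega)] at h1
    rw [Nat.succ_eq_add_one, hc.d_succ i (by omega)] at h2
    obtain ⟨-, h5, h6⟩ := h i (hc.mem_jobs (by omega))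
    obtain ⟨h7, h8⟩ := hti
    obtain ⟨h9, h10⟩ := htj
    generalize τ.start j = a at *
    simp only [τ] at h7 h8
    split_ifs at h7 h8 with hcase
    · linarith
    · simp only [hL] at *
      linarith
  calc EOPT I α ≤ eEnergy I τ α := EOPT_le_eEnergy hτ α
    _ ≤ ∑ j ∈ I.jobs, τ.speed j ^ α * (I.p j / τ.speed j) := by
      refine eEnergy_le_of_pairwise_disjoint hτ hα fun i hi j hj t hti htj => ?_
      rw [hc.jobs_eq, Finset.mem_range, Nat.lt_succ_iff] at hi hj
      rw [hdur i hi] at hti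
      rw [hdur j hj] at htj
      rcases lt_trichotomy i j with hij | hij | hij
      · exact absurd htj (havoid i j hij hj t hti)
      · exact hij
      · exact absurd hti (havoid j i hij hi t htj)
    _ = ∑ _j ∈ I.jobs, (3 : ℝ) ^ (α - 1) := Finset.sum_congr rfl fun j hj => by
      rw [hc.jobs_eq, Finset.mem_range, Nat.lt_succ_iff] at hj
      rw [hdur j hj]
      have hu : u j ^ α * L j = 1 := hc.u_pow j hj
      have h3 : (3 : ℝ) ^ α = 3 ^ (α - 1) * 3 := (pow_sub_one_mul hα 3).symm
      calc (3 * u j) ^ α * (L j / 3) = 3 ^ α * (u j ^ α * L j) / 3 := by rw [mul_pow]; ring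
        _ = 3 ^ (α - 1) := by rw [hu, h3]; ring
    _ = _ := by simp [hc.jobs_eq]

/-- All jobs run simultaneously while the last one is executed. -/
theorem sum_pow_mul_le_eEnergy (hc : IsNestedChain α k I σ u) (h : EFeasible I σ) (hα : α ≠ 0) :
    (∑ j ∈ I.jobs, σ.speed j) ^ α * (I.p k / σ.speed k) ≤ eEnergy I σ α := by
  have hk := hc.mem_jobs le_rfl
  refine pow_mul_le_eEnergy h hα ((I.r_nonneg k hk).trans (h k hk).2.1)
    (hc.duration_pos h le_rfl).le (Finset.sum_nonneg fun j hj => (h j hj).1.le) fun t ht => ?_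
  unfold machineSpeed
  rw [Finset.filter_true_of_mem]
  intro j hj
  rw [hc.jobs_eq, Finset.mem_range, Nat.lt_succ_iff] at hj
  obtain ⟨h1, h2⟩ := hc.execution_nested h hj le_rfl
  exact ⟨h1.trans ht.1, ht.2.trans_le h2⟩

theorem ratio_le (hc : IsNestedChain α k I σ u) (h : EFeasible I σ) (hα : α ≠ 0)
    (hk : k + 1 ≤ α) {v : ℝ} (hv : 0 < v) (hvD : v ^ α * (I.p k / σ.speed k) = 3)
    (hsum : v * (4 * α / 9) ≤ ∑ j ∈ I.jobs, σ.speed j) :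
    ((α : ℝ) / 9) ^ α * EOPT I α ≤ eEnergy I σ α := by
  have hk' : (k : ℝ) + 1 ≤ α := by exact_mod_cast hk
  have hgrowth : (α : ℝ) * 3 ^ α ≤ 9 * 4 ^ α := by
    have hb := one_add_mul_le_pow (a := (1 / 3 : ℝ)) (by norm_num) α
    have h4 : (4 : ℝ) ^ α = (1 + 1 / 3) ^ α * 3 ^ α := by
      rw [← mul_pow]; norm_num
    rw [h4, ← mul_assoc]
    gcongr
    have : (0 : ℝ) ≤ α := by positivity
    linarith
  have hopt : EOPT I α ≤ 3 * 4 ^ α := by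
    have h1 := hc.EOPT_le h hα
    have h3 : (3 : ℝ) ^ α = 3 ^ (α - 1) * 3 := (pow_sub_one_mul hα 3).symm
    have h2 : ((k : ℝ) + 1) * 3 ^ (α - 1) ≤ α * 3 ^ (α - 1) := by gcongr
    rw [h3] at hgrowth
    linarith
  calc ((α : ℝ) / 9) ^ α * EOPT I α ≤ ((α : ℝ) / 9) ^ α * (3 * 4 ^ α) := by gcongr
    _ = (4 * α / 9) ^ α * (v ^ α * (I.p k / σ.speed k)) := by
      rw [hvD, show (4 * (α : ℝ) / 9) = α / 9 * 4 by ring, mul_pow]; ring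
    _ = (v * (4 * α / 9)) ^ α * (I.p k / σ.speed k) := by rw [mul_pow]; ring
    _ ≤ (∑ j ∈ I.jobs, σ.speed j) ^ α * (I.p k / σ.speed k) := by
      have := (hc.duration_pos h le_rfl).le
      gcongr
    _ ≤ _ := hc.sum_pow_mul_le_eEnergy h hα

end IsNestedChain

theorem three_le_one_add_pow {α : ℕ} (hα : 2 ≤ α) : (3 : ℝ) ≤ (1 + 3 / (2 * α)) ^ α := by
  have hα' : (2 : ℝ) ≤ α := by exact_mod_cast hα
  have hpos : (0 : ℝ) < 1 + 3 / (2 * α) := by positivity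
  have hb := one_add_mul_self_le_rpow_one_add (s := 3 / (2 * (α : ℝ))) (p := α / 2)
    (by linarith [show (0 : ℝ) ≤ 3 / (2 * α) by positivity]) (by linarith)
  have h1 : (α : ℝ) / 2 * (3 / (2 * α)) = 3 / 4 := by field_simp; norm_num
  rw [h1] at hb
  have h2 : (1 + 3 / (2 * (α : ℝ))) ^ α = ((1 + 3 / (2 * (α : ℝ))) ^ ((α : ℝ) / 2)) ^ 2 := by
    rw [← Real.rpow_natCast _ 2, ← Real.rpow_mul hpos.le, ← Real.rpow_natCast]
    congr 1
    push_cast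
    ring
  rw [h2]
  nlinarith

/-- Growth of the total speed in one round: the new job has density `w`, the algorithm runs it at
speed `s`, and `v` is the density of the job released next. -/
theorem total_speed_step {α : ℕ} (hα : 2 ≤ α) {T w s v : ℝ} (hT : 0 ≤ T) (hTα : T + 1 ≤ α)
    (hw : 0 < w) (hws : w ≤ s) (hv : 0 < v) (hvs : v ^ α * w = 3 * s * w ^ α) :
    v * ((T + 1) / (1 + 3 / (2 * α))) ≤ w * T + s := by
  have hα0 : α ≠ 0 := by omega
  set b : ℝ := 1 + 3 / (2 * α) with hb
  have hb0 : 0 < b := by positivity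
  set y₀ : ℝ := (3 : ℝ) ^ ((α : ℝ)⁻¹) with hy₀
  have hy₀pos : 0 < y₀ := by positivity
  have hy₀pow : y₀ ^ α = 3 := Real.rpow_inv_natCast_pow (by norm_num) hα0
  have hy₀b : y₀ ≤ b := by
    refine le_of_pow_le_pow_left₀ hα0 hb0.le ?_
    rw [hy₀pow]
    exact three_le_one_add_pow hα
  set z : ℝ := v / (w * y₀) with hz
  have hvz : v = w * y₀ * z := by rw [hz]; field_simp
  have hzpow : w * z ^ α = s := by
    have h1 : w ^ α * (3 * (w * z ^ α)) = w ^ α * (3 * s) := by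
      have : v ^ α = w ^ α * 3 * z ^ α := by rw [hvz, mul_pow, mul_pow, hy₀pow]
      rw [this] at hvs
      linarith
    have h2 := mul_left_cancel₀ (pow_pos hw α).ne' h1
    linarith
  have hz0 : 0 < z := by positivity
  have hz1 : 1 ≤ z := by
    by_contra! hlt
    have : z ^ α < 1 := pow_lt_one₀ hz0.le hlt hα0
    nlinarith
  have hbern : 1 + α * (z - 1) ≤ z ^ α := by
    have := one_add_mul_le_pow (a := z - 1) (by linarith) α
    simpa using this
  have hmain : z * (T + 1) ≤ T + z ^ α := by nlinarith
  calc v * ((T + 1) / b) = w * (z * (T + 1)) * (y₀ / b) := by rw [hvz]; field_simp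
    _ ≤ w * (z * (T + 1)) * 1 := by
      gcongr
      exact (div_le_one hb0).2 hy₀b
    _ ≤ w * (T + z ^ α) := by rw [mul_one]; gcongr
    _ = w * T + s := by rw [mul_add, hzpow]

/-- The fixed point iteration behind the accumulated speed. -/
theorem iterate_eq {α : ℕ} (hα : 2 ≤ α) (n : ℕ) :
    ((2 * α / 3 : ℝ) * (1 - ((1 + 3 / (2 * α) : ℝ) ^ n)⁻¹) + 1) / (1 + 3 / (2 * α)) =
      (2 * α / 3) * (1 - ((1 + 3 / (2 * α) : ℝ) ^ (n + 1))⁻¹) := by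
  have hα' : (0 : ℝ) < α := by exact_mod_cast (by omega : 0 < α)
  have hb : (2 * α / 3 : ℝ) * (1 + 3 / (2 * α)) = 2 * α / 3 + 1 := by field_simp
  have hb0 : (0 : ℝ) < 1 + 3 / (2 * α) := by positivity
  generalize (1 + 3 / (2 * α) : ℝ) = b at *
  have hbn := (pow_pos hb0 n).ne'
  rw [div_eq_iff hb0.ne', pow_succ, mul_inv]
  have : b⁻¹ * b = 1 := inv_mul_cancel₀ hb0.ne'
  linear_combination -hb - (2 * α / 3 : ℝ) * (b ^ n)⁻¹ * (-this)

theorem exists_pow_mul_eq_three {α : ℕ} (hα : α ≠ 0) {D : ℝ} (hD : 0 < D) :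
    ∃ v : ℝ, 0 < v ∧ v ^ α * D = 3 := by
  refine ⟨(3 / D) ^ ((α : ℝ)⁻¹), by positivity, ?_⟩
  rw [Real.rpow_inv_natCast_pow (by positivity) hα]
  field_simp

/-- Releasing a job whose span is the middle third of the execution interval of the last job. -/
theorem IsNestedChain.exists_succ {α k : ℕ} {A : EAlgo} (honline : EOnline A)
    {I : EInstance} {u : ℕ → ℝ} (hc : IsNestedChain α k I (A I) u) (h : EFeasible I (A I))
    {v : ℝ} (hv : 0 < v) (hvD : v ^ α * (I.p k / (A I).speed k) = 3) :
    ∃ (I' : EInstance) (u' : ℕ → ℝ), IsNestedChain α (k + 1) I' (A I') u' ∧ u' (k + 1) = v ∧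
      ∀ j ≤ k, (A I').speed j = (A I).speed j := by
  set S := (A I).start k with hS
  set D := I.p k / (A I).speed k with hD
  have hDpos : 0 < D := hc.duration_pos h le_rfl
  have hS0 : 0 ≤ S := (I.r_nonneg k (hc.mem_jobs le_rfl)).trans (h k (hc.mem_jobs le_rfl)).2.1
  have hjobs : ∀ j ∈ Finset.range (k + 2), j ≠ k + 1 → j ∈ I.jobs := fun j hj hne =>
    hc.mem_jobs (by rw [Finset.mem_range] at hj; omega)
  let I' : EInstance :=
    { jobs := Finset.range (k + 2)
      r := Function.update I.r (k + 1) (S + D / 3)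
      d := Function.update I.d (k + 1) (S + 2 * (D / 3))
      p := Function.update I.p (k + 1) (v * (D / 3))
      r_nonneg := fun j hj => by
        rcases eq_or_ne j (k + 1) with rfl | hne
        · rw [Function.update_self]; positivity
        · rw [Function.update_of_ne hne]; exact I.r_nonneg j (hjobs j hj hne)
      r_lt_d := fun j hj => by
        rcases eq_or_ne j (k + 1) with rfl | hne
        · rw [Function.update_self, Function.update_self]; linarith
        · rw [Function.update_of_ne hne, Function.update_of_ne hne]
          exact I.r_lt_d j (hjobs j hj hne)
      p_pos := fun j hj => by
        rcases eq_or_ne j (k + 1) with rfl | hne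
        · rw [Function.update_self]; positivity
        · rw [Function.update_of_ne hne]; exact I.p_pos j (hjobs j hj hne) }
  have hr : ∀ j ≤ k, I'.r j = I.r j := fun j hj => Function.update_of_ne (by omega) _ _
  have hd : ∀ j ≤ k, I'.d j = I.d j := fun j hj => Function.update_of_ne (by omega) _ _
  have hp : ∀ j ≤ k, I'.p j = I.p j := fun j hj => Function.update_of_ne (by omega) _ _
  have hr' : I'.r (k + 1) = S + D / 3 := Function.update_self _ _ _
  have hd' : I'.d (k + 1) = S + 2 * (D / 3) := Function.update_self _ _ _
  have hp' : I'.p (k + 1) = v * (D / 3) := Function.update_self _ _ _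
  have hagree : EAgreeUpTo I I' S := by
    refine ⟨?_, fun j hj => ?_⟩
    · ext j
      rw [Finset.mem_filter, Finset.mem_filter, hc.jobs_eq]
      change j ∈ Finset.range (k + 1) ∧ _ ↔ j ∈ Finset.range (k + 2) ∧ _
      rw [Finset.mem_range, Finset.mem_range]
      constructor
      · rintro ⟨hj, hle⟩
        exact ⟨by omega, by rwa [hr j (by omega)]⟩
      · rintro ⟨hj, hle⟩
        rcases eq_or_ne j (k + 1) with rfl | hne
        · rw [hr'] at hle; linarith
        · exact ⟨by omega, by rwa [hr j (by omega)] at hle⟩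
    · have hjk : j ≤ k := by
        have := (Finset.mem_filter.1 hj).1
        rw [hc.jobs_eq, Finset.mem_range] at this
        omega
      exact ⟨(hr j hjk).symm, (hd j hjk).symm, (hp j hjk).symm⟩
  have hsame : ∀ j ≤ k, (A I).start j = (A I').start j ∧ (A I).speed j = (A I').speed j := by
    intro j hj
    have hjS := (hc.execution_nested h hj le_rfl).1
    refine honline I I' S hagree j (Finset.mem_filter.2 ⟨hc.mem_jobs hj, ?_⟩) (Or.inl hjS)
    exact (h j (hc.mem_jobs hj)).2.1.trans hjS
  refine ⟨I', Function.update u (k + 1) v, ⟨rfl, fun j hj => ?_, fun j hj => ?_, fun j hj => ?_,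
    fun j hj => ?_, fun j hj => ?_⟩, Function.update_self _ _ _, fun j hj => (hsame j hj).2.symm⟩
  · rcases Nat.le_succ_iff.1 hj with hj | rfl
    · rw [Function.update_of_ne (by omega)]; exact hc.u_pos j hj
    · rwa [Function.update_self]
  · rcases Nat.le_succ_iff.1 hj with hj | rfl
    · rw [Function.update_of_ne (by omega), hd j hj, hr j hj]; exact hc.u_pow j hj
    · rw [Function.update_self, Nat.succ_eq_add_one, hd', hr']
      linear_combination hvD / 3
  · rcases Nat.le_succ_iff.1 hj with hj | rfl
    · rw [Function.update_of_ne (by omega), hd j hj, hr j hj, hp j hj]; exact hc.p_eq j hj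
    · rw [Function.update_self, Nat.succ_eq_add_one, hd', hr', hp']
      ring
  · rcases Nat.lt_succ_iff_lt_or_eq.1 hj with hj | rfl
    · rw [hr _ hj, hp _ hj.le, ← (hsame j hj.le).1, ← (hsame j hj.le).2]; exact hc.r_succ j hj
    · rw [hr', hp _ le_rfl, ← (hsame j le_rfl).1, ← (hsame j le_rfl).2]
  · rcases Nat.lt_succ_iff_lt_or_eq.1 hj with hj | rfl
    · rw [hd _ hj, hp _ hj.le, ← (hsame j hj.le).1, ← (hsame j hj.le).2]; exact hc.d_succ j hj
    · rw [hd', hp _ le_rfl, ← (hsame j le_rfl).1, ← (hsame j le_rfl).2]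

theorem IsNestedChain.u_le_speed {α k : ℕ} {I : EInstance} {σ : ESchedule} {u : ℕ → ℝ}
    (hc : IsNestedChain α k I σ u) (h : EFeasible I σ) {j : ℕ} (hj : j ≤ k) :
    u j ≤ σ.speed j := by
  have := h.density_le_speed (hc.mem_jobs hj)
  rwa [hc.p_eq j hj,
    mul_div_cancel_right₀ _ (sub_pos.2 (I.r_lt_d j (hc.mem_jobs hj))).ne'] at this

theorem IsNestedChain.pow_mul_u_eq {α k : ℕ} {I : EInstance} {σ : ESchedule} {u : ℕ → ℝ}
    (hc : IsNestedChain α k I σ u) (h : EFeasible I σ) {v : ℝ}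
    (hvD : v ^ α * (I.p k / σ.speed k) = 3) :
    v ^ α * u k = 3 * σ.speed k * u k ^ α := by
  have hs := (h k (hc.mem_jobs le_rfl)).1.ne'
  have h1 := hc.u_pow k le_rfl
  rw [hc.p_eq k le_rfl] at hvD
  field_simp at hvD
  linear_combination u k ^ α * hvD - v ^ α * u k * h1

/-- Against every online algorithm there is an instance with positive optimal energy on which the
algorithm consumes at least `(α / 9) ^ α` times the optimal energy. -/
theorem exists_EOPT_pos_and_ratio_le {α : ℕ} (hα : 2 ≤ α) {A : EAlgo} (honline : EOnline A)
    (hfeas : ∀ I : EInstance, EFeasible I (A I)) :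
    ∃ I : EInstance, 0 < EOPT I α ∧ ((α : ℝ) / 9) ^ α * EOPT I α ≤ eEnergy I (A I) α := by
  have hα0 : α ≠ 0 := by omega
  have hα' : (2 : ℝ) ≤ α := by exact_mod_cast hα
  by_contra! hbad
  have hsmall : ∀ k I u, IsNestedChain α k I (A I) u → k + 1 ≤ α → ∀ v : ℝ, 0 < v →
      v ^ α * (I.p k / (A I).speed k) = 3 →
      ∑ j ∈ I.jobs, (A I).speed j < v * (4 * α / 9) := by
    intro k I u hc hk v hv hvD
    by_contra! hge
    exact (hbad I (EOPT_pos ⟨k, hc.mem_jobs le_rfl⟩ (hfeas I) hα0)).not_ge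
      (hc.ratio_le (hfeas I) hα0 hk hv hvD hge)
  have hchain : ∀ k, k + 1 ≤ α → ∃ I u, IsNestedChain α k I (A I) u ∧ ∀ v : ℝ, 0 < v →
      v ^ α * (I.p k / (A I).speed k) = 3 →
      v * ((2 * α / 3) * (1 - ((1 + 3 / (2 * α) : ℝ) ^ (k + 1))⁻¹)) ≤
        ∑ j ∈ I.jobs, (A I).speed j := by
    intro k
    induction k with
    | zero =>
      intro _
      let I : EInstance :=
        { jobs := Finset.range 1, r := fun _ => 0, d := fun _ => 1, p := fun _ => 1
          r_nonneg := fun _ _ => le_rfl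
          r_lt_d := fun _ _ => zero_lt_one
          p_pos := fun _ _ => zero_lt_one }
      have hc : IsNestedChain α 0 I (A I) fun _ => 1 :=
        ⟨rfl, by simp, by simp [I], by simp [I], by simp, by simp⟩
      refine ⟨I, _, hc, fun v hv hvD => ?_⟩
      have hstep := total_speed_step hα le_rfl (by linarith) (hc.u_pos 0 le_rfl)
        (hc.u_le_speed (hfeas I) le_rfl) hv (hc.pow_mul_u_eq (hfeas I) hvD)
      rw [← iterate_eq hα 0, pow_zero, inv_one, sub_self, mul_zero, hc.jobs_eq]
      simpa using hstep
    | succ k ih =>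
      intro hk
      obtain ⟨I, u, hc, hI⟩ := ih (by omega)
      obtain ⟨v, hv, hvD⟩ := exists_pow_mul_eq_three hα0 (hc.duration_pos (hfeas I) le_rfl)
      obtain ⟨I', u', hc', hu', hspeed⟩ := hc.exists_succ honline (hfeas I) hv hvD
      refine ⟨I', u', hc', fun v' hv' hvD' => ?_⟩
      have hlow := hI v hv hvD
      have hup := hsmall k I u hc (by omega) v hv hvD
      set T : ℝ := (2 * α / 3) * (1 - ((1 + 3 / (2 * α) : ℝ) ^ (k + 1))⁻¹) with hT
      have hT0 : 0 ≤ T := by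
        have hb : (1 : ℝ) ≤ (1 + 3 / (2 * α)) ^ (k + 1) :=
          one_le_pow₀ (by linarith [show (0 : ℝ) ≤ 3 / (2 * α) by positivity])
        have := inv_le_one_of_one_le₀ hb
        exact mul_nonneg (by positivity) (by linarith)
      have hTα : T < 4 * α / 9 := lt_of_mul_lt_mul_left (hlow.trans_lt hup) hv.le
      have hstep := total_speed_step hα hT0 (by linarith) (hc'.u_pos (k + 1) le_rfl)
        (hc'.u_le_speed (hfeas I') le_rfl) hv' (hc'.pow_mul_u_eq (hfeas I') hvD')
      rw [hT, iterate_eq hα (k + 1), ← hT, hu'] at hstep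
      refine hstep.trans ?_
      rw [hc'.jobs_eq, Finset.sum_range_succ]
      gcongr
      refine hlow.trans_eq ?_
      rw [hc.jobs_eq]
      exact Finset.sum_congr rfl fun j hj =>
        (hspeed j (Nat.lt_succ_iff.1 (Finset.mem_range.1 hj))).symm
  obtain ⟨I, u, hc, hI⟩ := hchain (α - 1) (by omega)
  obtain ⟨v, hv, hvD⟩ := exists_pow_mul_eq_three hα0 (hc.duration_pos (hfeas I) le_rfl)
  have hlow := hI v hv hvD
  have hup := hsmall _ I u hc (by omega) v hv hvD
  rw [Nat.sub_add_cancel (by omega)] at hlow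
  have hinv : ((1 + 3 / (2 * α) : ℝ) ^ α)⁻¹ ≤ 3⁻¹ :=
    inv_anti₀ three_pos (three_le_one_add_pow hα)
  have hlt := lt_of_mul_lt_mul_left (hlow.trans_lt hup) hv.le
  nlinarith

/-- **Lemma 2.** For every integer `α ≥ 2`, every deterministic online algorithm for
single-machine non-preemptive energy minimization with power function `P(s) = s^α`
has competitive ratio at least `(α/9)^α`: there is an instance on which the
algorithm's energy consumption is at least `(α/9)^α` times the optimal offline one. -/
theorem energy_lower_bound (α : ℕ) (hα : 2 ≤ α) (A : EAlgo) (honline : EOnline A)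
    (hfeas : ∀ I : EInstance, EFeasible I (A I)) :
    ∃ I : EInstance, ((α : ℝ) / 9) ^ α * EOPT I α ≤ eEnergy I (A I) α := by
  obtain ⟨I, -, hI⟩ := exists_EOPT_pos_and_ratio_le hα honline hfeas
  exact ⟨I, hI⟩
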